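/- Let F : ℂ^{k+1} → ℂ^{k+1} be a nondegenerate homogeneous polynomial map of degree d, and let C > 1 be a constant satisfying 1/C ≤ ‖F(z)‖ ≤ C for every z with ‖z‖ = 1. Then the sequence of functions G_{F,n}(z) := d^{-n} log ‖F^{∘n}(z)‖ converges uniformly on ℂ^{k+1} \ {0} to a continuous function G_F, and moreover sup_{z ≠ 0} |G_{F,n}(z) − G_F(z)| ≤ (log C)/(d^n (d−1)) for every n ∈ ℕ. -/

import Mathlib

open Filter Topology

noncomputable section

/-- `F` is a map `ℂ^{k+1} → ℂ^{k+1}` each of whose components is a homogeneous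
polynomial of degree `d` in the coordinates. -/
def IsHomPoly (k d : ℕ)
    (F : EuclideanSpace ℂ (Fin (k + 1)) → EuclideanSpace ℂ (Fin (k + 1))) : Prop :=
  ∀ i : Fin (k + 1), ∃ P : MvPolynomial (Fin (k + 1)) ℂ,
    P.IsHomogeneous d ∧ ∀ z, F z i = MvPolynomial.eval (fun j => z j) P

/-- `F` is nondegenerate: `F z = 0` implies `z = 0`. -/
def IsNondeg (k : ℕ)
    (F : EuclideanSpace ℂ (Fin (k + 1)) → EuclideanSpace ℂ (Fin (k + 1))) : Prop :=
  ∀ z, F z = 0 → z = 0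

theorem stmt0 (k d : ℕ) (hk : 1 ≤ k) (hd : 2 ≤ d)
    (F : EuclideanSpace ℂ (Fin (k + 1)) → EuclideanSpace ℂ (Fin (k + 1)))
    (hpoly : IsHomPoly k d F) (hnd : IsNondeg k F)
    (C : ℝ) (hC : 1 < C)
    (hbound : ∀ z : EuclideanSpace ℂ (Fin (k + 1)), ‖z‖ = 1 → 1 / C ≤ ‖F z‖ ∧ ‖F z‖ ≤ C) :
    ∃ G : EuclideanSpace ℂ (Fin (k + 1)) → ℝ,
      ContinuousOn G {z | z ≠ 0} ∧
      TendstoUniformlyOn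
        (fun (n : ℕ) (z : EuclideanSpace ℂ (Fin (k + 1))) =>
          ((d : ℝ) ^ n)⁻¹ * Real.log ‖F^[n] z‖) G atTop {z | z ≠ 0} ∧
      ∀ n : ℕ, ∀ z : EuclideanSpace ℂ (Fin (k + 1)), z ≠ 0 →
        |((d : ℝ) ^ n)⁻¹ * Real.log ‖F^[n] z‖ - G z| ≤
          Real.log C / ((d : ℝ) ^ n * ((d : ℝ) - 1)) := by
  have hd' : (2 : ℝ) ≤ d := by exact_mod_cast hd
  have hd0 : (0 : ℝ) < d := by linarith
  have hlogC : 0 < Real.log C := Real.log_pos hC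
  have hcont : Continuous F := by
    refine (PiLp.continuous_toLp 2 _).comp (g := WithLp.toLp 2)
      (f := fun z => fun i => F z i) (continuous_pi fun i => ?_)
    obtain ⟨P, -, hP⟩ := hpoly i
    simp only [hP]
    have h1 : Continuous fun x : Fin (k + 1) → ℂ => MvPolynomial.eval x P :=
      MvPolynomial.continuous_eval P
    exact h1.comp (by fun_prop)
  have hhom : ∀ (c : ℂ) z, F (c • z) = c ^ d • F z := by
    intro c z
    ext i
    obtain ⟨P, hP1, hP⟩ := hpoly i
    simp only [PiLp.smul_apply, hP, smul_eq_mul]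
    rw [MvPolynomial.eval_eq, MvPolynomial.eval_eq, Finset.mul_sum]
    refine Finset.sum_congr rfl fun m hm => ?_
    have hdeg : ∑ j, m j = d := by
      have h := hP1 (MvPolynomial.mem_support_iff.mp hm)
      rw [Finsupp.weight_apply, Finsupp.sum_fintype _ _ (by simp)] at h
      simpa using h
    simp only [mul_pow, Finset.prod_mul_distrib]
    rw [show ∏ j ∈ m.support, c ^ m j = c ^ d by
      rw [Finset.prod_pow_eq_pow_sum, ← hdeg]
      congr 1
      exact Finset.sum_subset (Finset.subset_univ _) (by simp)]
    ring
  have hF0 : ∀ z, z ≠ 0 → F z ≠ 0 := fun z hz h => hz (hnd z h)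
  have hit : ∀ n z, z ≠ 0 → F^[n] z ≠ 0 := by
    intro n
    induction n with
    | zero => intro z hz; simpa using hz
    | succ n ih => intro z hz; rw [Function.iterate_succ_apply']; exact hF0 _ (ih z hz)
  have hone : ∀ z, z ≠ 0 → |Real.log ‖F z‖ - d * Real.log ‖z‖| ≤ Real.log C := by
    intro z hz
    have hn : ‖z‖ ≠ 0 := norm_ne_zero_iff.mpr hz
    set w : EuclideanSpace ℂ (Fin (k + 1)) := ((‖z‖ : ℂ)⁻¹) • z with hw
    have hw1 : ‖w‖ = 1 := by
      rw [hw, norm_smul]; simp [hn]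
    have hw0 : w ≠ 0 := by intro h; simp [h] at hw1
    have hz' : z = (‖z‖ : ℂ) • w := by
      rw [hw, smul_smul, mul_inv_cancel₀ (by exact_mod_cast hn), one_smul]
    have hFz : ‖F z‖ = ‖z‖ ^ d * ‖F w‖ := by
      conv_lhs => rw [hz', hhom, norm_smul]
      simp
    have hFw : ‖F w‖ ≠ 0 := norm_ne_zero_iff.mpr (hF0 w hw0)
    rw [hFz, Real.log_mul (pow_ne_zero _ hn) hFw, Real.log_pow, add_sub_cancel_left]
    obtain ⟨h1, h2⟩ := hbound w hw1
    have h3 := Real.log_le_log (by positivity) h1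
    have h4 := Real.log_le_log (by positivity) h2
    rw [one_div, Real.log_inv] at h3
    exact abs_le.mpr ⟨h3, h4⟩
  set u : ℕ → EuclideanSpace ℂ (Fin (k + 1)) → ℝ :=
    fun n z => ((d : ℝ) ^ n)⁻¹ * Real.log ‖F^[n] z‖ with hu
  have hr : (d : ℝ)⁻¹ < 1 := inv_lt_one_of_one_lt₀ (by linarith)
  have hstep : ∀ z, z ≠ 0 → ∀ n, dist (u n z) (u (n + 1) z) ≤
      (Real.log C / d) * ((d : ℝ)⁻¹) ^ n := by
    intro z hz n
    have h := hone _ (hit n z hz)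
    rw [dist_comm, Real.dist_eq]
    have e : u (n + 1) z - u n z = ((d : ℝ) ^ (n + 1))⁻¹ *
        (Real.log ‖F (F^[n] z)‖ - d * Real.log ‖F^[n] z‖) := by
      simp only [hu, Function.iterate_succ_apply']
      field_simp
      ring
    rw [e, abs_mul, abs_of_pos (by positivity)]
    calc _ ≤ ((d : ℝ) ^ (n + 1))⁻¹ * Real.log C := by gcongr
      _ = _ := by rw [inv_pow, pow_succ]; field_simp
  have hlim : ∀ z, ∃ g, z ≠ 0 → Tendsto (fun n => u n z) atTop (𝓝 g) := by
    intro z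
    by_cases hz : z = 0
    · exact ⟨0, fun h => absurd hz h⟩
    · obtain ⟨g, hg⟩ := cauchySeq_tendsto_of_complete
        (cauchySeq_of_le_geometric _ _ hr (hstep z hz))
      exact ⟨g, fun _ => hg⟩
  choose G hG using hlim
  have hest : ∀ n z, z ≠ 0 → |u n z - G z| ≤
      Real.log C / ((d : ℝ) ^ n * ((d : ℝ) - 1)) := by
    intro n z hz
    have h := dist_le_of_le_geometric_of_tendsto _ _ hr (hstep z hz) (hG z hz) n
    rw [Real.dist_eq] at h
    refine h.trans_eq ?_
    have h1 : (d : ℝ) - 1 ≠ 0 := by linarith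
    have h2 : 1 - (d : ℝ)⁻¹ ≠ 0 := by linarith
    have h3 : 1 - (d : ℝ)⁻¹ = (d - 1) / d := by field_simp
    rw [h3, inv_pow]
    field_simp
  have hunif : TendstoUniformlyOn u G atTop {z | z ≠ 0} := by
    rw [Metric.tendstoUniformlyOn_iff]
    intro ε hε
    have ht : Tendsto (fun n : ℕ => (Real.log C / ((d : ℝ) - 1)) * ((d : ℝ)⁻¹) ^ n)
        atTop (𝓝 0) := by
      simpa using (tendsto_pow_atTop_nhds_zero_of_lt_one (by positivity) hr).const_mul
        (Real.log C / ((d : ℝ) - 1))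
    filter_upwards [ht.eventually_lt_const hε] with n hn z hz
    rw [dist_comm, Real.dist_eq]
    refine (hest n z hz).trans_lt (lt_of_eq_of_lt ?_ hn)
    have h1 : (d : ℝ) - 1 ≠ 0 := by linarith
    rw [inv_pow]
    field_simp
  refine ⟨G, ?_, hunif, hest⟩
  refine hunif.continuousOn (Eventually.of_forall fun n => ?_).frequently
  refine ContinuousOn.mul continuousOn_const (ContinuousOn.log ?_ ?_)
  · exact (hcont.iterate n).norm.continuousOn
  · intro z hz
    exact norm_ne_zero_iff.mpr (hit n z hz)
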